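/- The spectral radius of Ā is strictly less than 1. -/

import Mathlib

open Matrix Finset

/-- The standard basis vector of `ℝ^{n²}` (indexed by pairs, the pair `(i,j)` encoding
coordinate `(i−1)n + j`) with a 1 in coordinate `(i,j)`. -/
def eVec (n : ℕ) (i j : Fin n) : Fin n × Fin n → ℝ :=
  fun q => if q = (i, j) then 1 else 0

/-- The communication matrix `O(i,j) = I + e_i^j(e_j^j − e_i^j)ᵀ + e_j^i(e_i^i − e_j^i)ᵀ`. -/
def Omat (n : ℕ) (i j : Fin n) : Matrix (Fin n × Fin n) (Fin n × Fin n) ℝ :=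
  1 + Matrix.vecMulVec (eVec n i j) (eVec n j j - eVec n i j)
    + Matrix.vecMulVec (eVec n j i) (eVec n i i - eVec n j i)

/-- The `n² × n²` block-diagonal matrix with `n` diagonal blocks equal to `M`. -/
def blockDiag (n : ℕ) (M : Matrix (Fin n) (Fin n) ℝ) :
    Matrix (Fin n × Fin n) (Fin n × Fin n) ℝ :=
  Matrix.of fun q r => if q.1 = r.1 then M q.2 r.2 else 0

/-- The update matrix `U(i,j) = I + (e_i^i(e_i^i)ᵀ + e_j^j(e_j^j)ᵀ)(M_blk − I)`. -/
def Umat (n : ℕ) (M : Matrix (Fin n) (Fin n) ℝ) (i j : Fin n) :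
    Matrix (Fin n × Fin n) (Fin n × Fin n) ℝ :=
  1 + (Matrix.vecMulVec (eVec n i i) (eVec n i i)
      + Matrix.vecMulVec (eVec n j j) (eVec n j j)) * (blockDiag n M - 1)

/-- The diagonal matrix `I^E` with entry `(i,j)` equal to 1 if `(i,j) ∈ E` or `i = j`,
and 0 otherwise (edges are the pairs with `W i j > 0`). -/
noncomputable def IEmat (n : ℕ) (W : Matrix (Fin n) (Fin n) ℝ) :
    Matrix (Fin n × Fin n) (Fin n × Fin n) ℝ :=
  Matrix.diagonal fun q => if 0 < W q.1 q.2 ∨ q.1 = q.2 then 1 else 0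

/-- A complex eigenvalue has a nonzero eigenvector. -/
lemma exists_eigenvector_of_mem_spectrum {ι : Type*} [Fintype ι] [DecidableEq ι]
    {B : Matrix ι ι ℂ} {μ : ℂ} (hμ : μ ∈ spectrum ℂ B) : ∃ x ≠ 0, B *ᵥ x = μ • x := by
  rw [spectrum.mem_iff, Matrix.isUnit_iff_isUnit_det, isUnit_iff_ne_zero, not_not,
    ← Matrix.exists_mulVec_eq_zero_iff] at hμ
  obtain ⟨x, hx, h⟩ := hμ
  refine ⟨x, hx, ?_⟩
  rw [Matrix.sub_mulVec, sub_eq_zero, Algebra.algebraMap_eq_smul_one, Matrix.smul_mulVec,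
    Matrix.one_mulVec] at h
  exact h.symm

/-- A substochastic matrix in which every row either has sum less than one, or has a positive
entry in the column of such a row, has spectral radius less than one. -/
lemma norm_lt_one_of_mem_spectrum_substochastic {ι : Type*} [Fintype ι] [DecidableEq ι]
    {A : Matrix ι ι ℝ} (hnn : ∀ q r, 0 ≤ A q r) (hrow : ∀ q, ∑ r, A q r ≤ 1)
    (hdef : ∀ q, ∑ r, A q r < 1 ∨ ∃ r, 0 < A q r ∧ ∑ s, A r s < 1)
    {μ : ℂ} (hμ : μ ∈ spectrum ℂ (A.map Complex.ofReal)) : ‖μ‖ < 1 := by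
  obtain ⟨x, hx, h⟩ := exists_eigenvector_of_mem_spectrum hμ
  by_contra! hμ1
  obtain ⟨k, hk⟩ := Function.ne_iff.mp hx
  obtain ⟨q, -, hq⟩ := Finset.exists_max_image univ (fun q => ‖x q‖) ⟨k, mem_univ k⟩
  have hpos : 0 < ‖x q‖ := (norm_pos_iff.mpr hk).trans_le (hq k (mem_univ k))
  have hle : ∀ r, ‖x r‖ ≤ ∑ s, A r s * ‖x s‖ := fun r => calc
    ‖x r‖ ≤ ‖μ‖ * ‖x r‖ := le_mul_of_one_le_left (norm_nonneg _) hμ1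
    _ = ‖∑ s, (A r s : ℂ) * x s‖ := by
      rw [← norm_mul]
      exact congrArg norm (congrFun h r).symm
    _ ≤ ∑ s, A r s * ‖x s‖ := by
      refine (norm_sum_le _ _).trans_eq (Finset.sum_congr rfl fun s _ => ?_)
      rw [norm_mul, Complex.norm_real, Real.norm_of_nonneg (hnn r s)]
  have key : ∀ r, ‖x r‖ = ‖x q‖ → ¬ ∑ s, A r s < 1 := fun r hr hlt => by
    have h1 : ∑ s, A r s * ‖x s‖ ≤ (∑ s, A r s) * ‖x q‖ := by
      rw [Finset.sum_mul]
      exact Finset.sum_le_sum fun s _ =>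
        mul_le_mul_of_nonneg_left (hq s (mem_univ s)) (hnn r s)
    nlinarith [hle r]
  obtain hlt | ⟨r, hr, hlt⟩ := hdef q
  · exact key q rfl hlt
  · refine key r (le_antisymm (hq r (mem_univ r)) ?_) hlt
    by_contra! hxr
    have h1 : ∑ s, A q s * ‖x s‖ < (∑ s, A q s) * ‖x q‖ := by
      rw [Finset.sum_mul]
      exact Finset.sum_lt_sum (fun s _ => mul_le_mul_of_nonneg_left (hq s (mem_univ s)) (hnn q s))
        ⟨r, mem_univ r, mul_lt_mul_of_pos_left hxr hr⟩
    nlinarith [hle q, hrow q]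

lemma Omat_apply {n : ℕ} {i j : Fin n} (hij : i ≠ j) (q r : Fin n × Fin n) :
    Omat n i j q r = if q = (i, j) then (if r = (j, j) then 1 else 0)
      else if q = (j, i) then (if r = (i, i) then 1 else 0) else if r = q then 1 else 0 := by
  have hne : (j, i) ≠ (i, j) := fun h => hij (Prod.ext_iff.mp h).2
  simp only [Omat, Matrix.add_apply, Matrix.one_apply, Matrix.vecMulVec_apply, eVec,
    Pi.sub_apply]
  by_cases h1 : q = (i, j)
  · subst h1
    simp [hne.symm, eq_comm]
  · by_cases h2 : q = (j, i)
    · subst h2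
      simp [hne, eq_comm]
    · simp [h1, h2, eq_comm]

lemma Umat_apply {n : ℕ} (M : Matrix (Fin n) (Fin n) ℝ) {i j : Fin n} (hij : i ≠ j)
    (q r : Fin n × Fin n) :
    Umat n M i j q r = if q = (i, i) ∨ q = (j, j) then blockDiag n M q r
      else if q = r then 1 else 0 := by
  have hne : (j, j) ≠ (i, i) := fun h => hij (Prod.ext_iff.mp h).1.symm
  have hmul : ∀ k, (Matrix.vecMulVec (eVec n k k) (eVec n k k) * (blockDiag n M - 1)) q r
      = if q = (k, k) then blockDiag n M q r - (1 : Matrix _ _ ℝ) q r else 0 := fun k => by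
    by_cases h : q = (k, k)
    · subst h
      simp [Matrix.mul_apply, Matrix.vecMulVec_apply, eVec]
    · simp [Matrix.mul_apply, Matrix.vecMulVec_apply, eVec, h]
  rw [Umat, add_mul, Matrix.add_apply, Matrix.add_apply, hmul, hmul, Matrix.one_apply]
  by_cases h1 : q = (i, i)
  · subst h1
    simp [hne.symm]
  · by_cases h2 : q = (j, j) <;> simp [h1, h2, hij.symm]

lemma sum_Omat {n : ℕ} {i j : Fin n} (hij : i ≠ j) (q : Fin n × Fin n) :
    ∑ r, Omat n i j q r = 1 := by
  simp only [Omat_apply hij]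
  split_ifs <;> simp

lemma sum_blockDiag {n : ℕ} (M : Matrix (Fin n) (Fin n) ℝ) (q : Fin n × Fin n) :
    ∑ r, blockDiag n M q r = ∑ k, M q.2 k := by
  simp [_root_.blockDiag, Fintype.sum_prod_type]

lemma sum_Umat {n : ℕ} (M : Matrix (Fin n) (Fin n) ℝ) {i j : Fin n} (hij : i ≠ j)
    (q : Fin n × Fin n) :
    ∑ r, Umat n M i j q r = if q = (i, i) ∨ q = (j, j) then ∑ k, M q.2 k else 1 := by
  simp only [Umat_apply M hij]
  split_ifs <;> simp [sum_blockDiag]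

lemma sum_Umat_mul_Omat {n : ℕ} (M : Matrix (Fin n) (Fin n) ℝ) {i j : Fin n} (hij : i ≠ j)
    (q : Fin n × Fin n) :
    ∑ r, (Umat n M i j * Omat n i j) q r
      = if q = (i, i) ∨ q = (j, j) then ∑ k, M q.2 k else 1 := by
  simp only [Matrix.mul_apply]
  rw [Finset.sum_comm]
  simp only [← Finset.mul_sum, sum_Omat hij, mul_one, sum_Umat M hij]

lemma Umat_mul_Omat_nonneg {n : ℕ} {M : Matrix (Fin n) (Fin n) ℝ} (hM : ∀ i j, 0 ≤ M i j)
    {i j : Fin n} (hij : i ≠ j) (q r : Fin n × Fin n) :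
    0 ≤ (Umat n M i j * Omat n i j) q r := by
  rw [Matrix.mul_apply]
  refine Finset.sum_nonneg fun s _ => mul_nonneg ?_ ?_
  · rw [Umat_apply M hij, _root_.blockDiag, Matrix.of_apply]
    split_ifs <;> simp [hM]
  · rw [Omat_apply hij]
    split_ifs <;> simp

lemma Umat_mul_Omat_apply_edge {n : ℕ} (M : Matrix (Fin n) (Fin n) ℝ) {i j : Fin n}
    (hij : i ≠ j) : (Umat n M i j * Omat n i j) (i, j) (j, j) = 1 := by
  rw [Matrix.mul_apply, Finset.sum_eq_single (i, j)]
  · simp [Umat_apply M hij, Omat_apply hij, hij, hij.symm]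
  · intro s _ hs
    simp [Umat_apply M hij, hij, hij.symm, hs.symm]
  · simp

lemma diagonal_inv_of_ne_zero {n : ℕ} {d : Fin n → ℝ} (hd : ∀ i, d i ≠ 0) :
    (Matrix.diagonal d)⁻¹ = Matrix.diagonal fun i => (d i)⁻¹ := by
  refine Matrix.inv_eq_left_inv ?_
  simp [Matrix.diagonal_mul_diagonal, hd]

lemma weighted_sum_le {ι : Type*} [Fintype ι] {p f : ι → ι → ℝ} (hp : ∀ i j, 0 ≤ p i j)
    (hf : ∀ i j, f i j ≤ 1) (hsum : ∀ i, ∑ j, p i j = 1) :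
    ∑ i, ∑ j, p i j * f i j ≤ Fintype.card ι := by
  calc ∑ i, ∑ j, p i j * f i j ≤ ∑ i, ∑ j, p i j := Finset.sum_le_sum fun i _ =>
        Finset.sum_le_sum fun j _ => mul_le_of_le_one_right (hp i j) (hf i j)
    _ = Fintype.card ι := by simp [hsum]

lemma weighted_sum_lt {ι : Type*} [Fintype ι] {p f : ι → ι → ℝ} (hp : ∀ i j, 0 ≤ p i j)
    (hf : ∀ i j, f i j ≤ 1) (hsum : ∀ i, ∑ j, p i j = 1) {a b : ι} (hab : 0 < p a b)
    (hfab : f a b < 1) : ∑ i, ∑ j, p i j * f i j < Fintype.card ι := by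
  have hle : ∀ i j, p i j * f i j ≤ p i j := fun i j => mul_le_of_le_one_right (hp i j) (hf i j)
  calc ∑ i, ∑ j, p i j * f i j < ∑ i, ∑ j, p i j :=
        Finset.sum_lt_sum (fun i _ => Finset.sum_le_sum fun j _ => hle i j) ⟨a, mem_univ a,
          Finset.sum_lt_sum (fun j _ => hle a j) ⟨b, mem_univ b, mul_lt_of_lt_one_right hab hfab⟩⟩
    _ = Fintype.card ι := by simp [hsum]

/-- The spectral radius of `Ā` is strictly less than 1 (every complex
eigenvalue has modulus < 1). -/
theorem spectral_radius_Abar_lt_one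
    (n : ℕ) (hn : 2 ≤ n)
    (W : Matrix (Fin n) (Fin n) ℝ)
    (hWsymm : ∀ i j, W i j = W j i)
    (hWnn : ∀ i j, 0 ≤ W i j)
    (hWdiag : ∀ i, W i i = 0)
    (hconn : (SimpleGraph.fromRel (fun i j => 0 < W i j)).Connected)
    (D : Matrix (Fin n) (Fin n) ℝ)
    (hD : D = Matrix.diagonal (fun i => ∑ j, W i j))
    (P : Matrix (Fin n) (Fin n) ℝ) (hP : P = D⁻¹ * W)
    (c : Fin n → ℝ) (hc : ∀ i, 0 < c i ∧ c i ≤ 1)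
    (C : Matrix (Fin n) (Fin n) ℝ) (hC : C = Matrix.diagonal c)
    (α : ℝ) (hα : 0 < α ∧ α < 1)
    (M : Matrix (Fin n) (Fin n) ℝ)
    (hM : M = (α • (1 : Matrix (Fin n) (Fin n) ℝ) + (1-α) • C)⁻¹ * (α • P))
    (π : Fin n → Fin n → ℝ)
    (hπnn : ∀ i j, 0 ≤ π i j)
    (hπsum : ∀ i, ∑ j, π i j = 1)
    (hπpos : ∀ i j, 0 < π i j ↔ 0 < W i j)
    (Abar : Matrix (Fin n × Fin n) (Fin n × Fin n) ℝ)
    (hAbar : Abar = (1/(n:ℝ)) •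
      (IEmat n W * ∑ i, ∑ j, if i = j then 0 else π i j • (Umat n M i j * Omat n i j))) :
    ∀ μ ∈ spectrum ℂ (Abar.map Complex.ofReal), ‖μ‖ < 1 := by
  have hn0 : (0 : ℝ) < n := by exact_mod_cast (by omega : 0 < n)
  have hne : ∀ {i j}, 0 < W i j → i ≠ j := fun {i j} h hij => by
    subst hij
    exact h.ne' (hWdiag i)
  have hπself : ∀ i, π i i = 0 := fun i => le_antisymm
    (not_lt.mp fun h => hne ((hπpos i i).mp h) rfl) (hπnn i i)
  have hnbr : ∀ i, ∃ j, 0 < π i j := fun i => by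
    obtain ⟨j, -, hj⟩ := Finset.exists_lt_of_sum_lt (s := univ) (f := fun _ => (0 : ℝ))
      (g := π i) (by simp [hπsum])
    exact ⟨j, hj⟩
  have hdeg : ∀ i, 0 < ∑ j, W i j := fun i => by
    obtain ⟨j, hj⟩ := hnbr i
    exact Finset.sum_pos' (fun k _ => hWnn i k) ⟨j, mem_univ j, (hπpos i j).mp hj⟩
  have hconf : ∀ i, 0 < (1 - α) * c i := fun i => mul_pos (sub_pos.mpr hα.2) (hc i).1
  have hden : ∀ i, 0 < α + (1 - α) * c i := fun i => add_pos hα.1 (hconf i)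
  have hMapply : ∀ i j, M i j = (α + (1 - α) * c i)⁻¹ * (α * ((∑ k, W i k)⁻¹ * W i j)) := by
    intro i j
    have hdiag : α • (1 : Matrix (Fin n) (Fin n) ℝ) + (1 - α) • C
        = Matrix.diagonal fun i => α + (1 - α) * c i := by
      ext a b
      by_cases hab : a = b <;> simp [hC, hab]
    rw [hM, hdiag, diagonal_inv_of_ne_zero fun i => (hden i).ne', Matrix.diagonal_mul,
      Matrix.smul_apply, hP, hD, diagonal_inv_of_ne_zero fun i => (hdeg i).ne',
      Matrix.diagonal_mul, smul_eq_mul]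
  have hMnn : ∀ i j, 0 ≤ M i j := fun i j => by
    rw [hMapply]
    have := hden i
    have := hdeg i
    have := hWnn i j
    have := hα.1
    positivity
  have hMrow : ∀ i, ∑ j, M i j < 1 := fun i => by
    simp only [hMapply, ← Finset.mul_sum]
    rw [inv_mul_cancel₀ (hdeg i).ne', mul_one, inv_mul_lt_one₀ (hden i)]
    linarith [hconf i]
  have hApply : ∀ q r, Abar q r = 1 / n * ((if 0 < W q.1 q.2 ∨ q.1 = q.2 then 1 else 0) *
      ∑ i, ∑ j, π i j * (Umat n M i j * Omat n i j) q r) := fun q r => by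
    rw [hAbar, Matrix.smul_apply, IEmat, Matrix.diagonal_mul, smul_eq_mul]
    simp only [Matrix.sum_apply]
    congr! 6 with i _ j _
    split_ifs with hij
    · simp [hij, hπself]
    · rfl
  have hterm : ∀ q r i j, 0 ≤ π i j * (Umat n M i j * Omat n i j) q r := fun q r i j => by
    by_cases hij : i = j
    · simp [hij, hπself]
    · exact mul_nonneg (hπnn i j) (Umat_mul_Omat_nonneg hMnn hij q r)
  have hAnn : ∀ q r, 0 ≤ Abar q r := fun q r => by
    rw [hApply]
    refine mul_nonneg (by positivity) (mul_nonneg (by split_ifs <;> simp) ?_)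
    exact Finset.sum_nonneg fun i _ => Finset.sum_nonneg fun j _ => hterm q r i j
  have hArow : ∀ q, ∑ r, Abar q r = 1 / n * ((if 0 < W q.1 q.2 ∨ q.1 = q.2 then 1 else 0) *
      ∑ i, ∑ j, π i j * if q = (i, i) ∨ q = (j, j) then ∑ k, M q.2 k else 1) := fun q => by
    simp only [hApply, ← Finset.mul_sum]
    rw [Finset.sum_comm]
    congr! 3 with i _
    rw [Finset.sum_comm]
    congr! 1 with j _
    by_cases hij : i = j
    · simp [hij, hπself]
    · rw [← Finset.mul_sum, sum_Umat_mul_Omat M hij]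
  have hf : ∀ (q : Fin n × Fin n) (i j : Fin n),
      (if q = (i, i) ∨ q = (j, j) then ∑ k, M q.2 k else 1) ≤ 1 := fun q i j => by
    split_ifs
    exacts [(hMrow _).le, le_rfl]
  have hAle : ∀ q, ∑ r, Abar q r ≤ 1 := fun q => by
    rw [hArow, one_div, inv_mul_le_one₀ hn0]
    have := weighted_sum_le hπnn (hf q) hπsum
    rw [Fintype.card_fin] at this
    split_ifs
    · rwa [one_mul]
    · rw [zero_mul]
      exact hn0.le
  have hAlt : ∀ a, ∑ r, Abar (a, a) r < 1 := fun a => by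
    obtain ⟨b, hb⟩ := hnbr a
    have := weighted_sum_lt hπnn (hf (a, a)) hπsum hb (by simpa using hMrow a)
    rw [Fintype.card_fin] at this
    rwa [hArow, if_pos (Or.inr rfl), one_mul, one_div, inv_mul_lt_one₀ hn0]
  intro μ hμ
  refine norm_lt_one_of_mem_spectrum_substochastic hAnn hAle ?_ hμ
  rintro ⟨a, b⟩
  by_cases hab : a = b
  · exact Or.inl (hab ▸ hAlt a)
  by_cases hW : 0 < W a b
  · refine Or.inr ⟨(b, b), ?_, hAlt b⟩
    rw [hApply, if_pos (Or.inl hW), one_mul]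
    refine mul_pos (by positivity) ?_
    refine Finset.sum_pos' (fun i _ => Finset.sum_nonneg fun j _ => hterm _ _ i j)
      ⟨a, mem_univ a, Finset.sum_pos' (fun j _ => hterm _ _ a j) ⟨b, mem_univ b, ?_⟩⟩
    rw [Umat_mul_Omat_apply_edge M hab, mul_one]
    exact (hπpos a b).mpr hW
  · left
    rw [hArow, if_neg (by simp [hW, hab]), zero_mul, mul_zero]
    exact one_pos
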